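/- Given a quasi-homogeneous polynomial W in N variables, the set X = {(x,b) ∈ C^N × C^N : ∂W/∂x_i(x) + b_i = 0 for all i, and det(∂²W/∂x_i∂x_j)(x) = 0} is an affine variety of complex dimension at most N−1, and consequently the set of W-regular linear perturbations W_0 = Σ b_i x_i (those for which W + W_0 is a holomorphic Morse function) is a non-empty, path-connected, open subset of C^N, being the complement of the algebraic set π_2(X) where π_2 is projection to the b-coordinates. -/

import Mathlib

open MvPolynomial

theorem MvPolynomial.eval_aeval_eq_eval {σ τ R : Type*} [CommSemiring R] (f : τ → MvPolynomial σ R)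
    (P : MvPolynomial τ R) (x : σ → R) : eval x (aeval f P) = eval (fun j ↦ eval x (f j)) P := by
  induction P using MvPolynomial.induction_on <;> simp_all

theorem MvPolynomial.weightedHomogeneousComponent_mul_of_right {σ R M : Type*} [CommSemiring R]
    [AddCancelCommMonoid M] {w : σ → M} {m n : M} {g f : MvPolynomial σ R}
    (hf : IsWeightedHomogeneous w f n) :
    weightedHomogeneousComponent w (m + n) (g * f) = weightedHomogeneousComponent w m g * f := by
  classical
  let := weightedGradedAlgebra R w
  have h := DirectSum.coe_decompose_mul_add_of_right_mem (weightedHomogeneousSubmodule R w)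
    (i := m) (a := g) ((mem_weightedHomogeneousSubmodule R w n f).2 hf)
  exact ((weightedDecomposition.decompose'_apply R w _ _).symm.trans h).trans
    (congrArg (· * f) (weightedDecomposition.decompose'_apply R w _ _))

/-- A weighted homogeneous system with no nontrivial common zero makes the polynomial ring integral
over the subalgebra which the system generates. -/
theorem MvPolynomial.isIntegral_adjoin_range_of_weightedHomogeneous {σ ι k : Type*} [Finite σ]
    [Finite ι] [Field k] [IsAlgClosed k] {w : σ → ℝ} (hw : ∀ i, 0 ≤ w i)
    {f : ι → MvPolynomial σ k} {d : ι → ℝ} (hd : ∀ j, 0 < d j)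
    (hf : ∀ j, IsWeightedHomogeneous w (f j) (d j))
    (hzero : ∀ x : σ → k, (∀ j, eval x (f j) = 0) → x = 0) :
    Algebra.IsIntegral (Algebra.adjoin k (Set.range f)) (MvPolynomial σ k) := by
  classical
  have := Fintype.ofFinite σ
  have := Fintype.ofFinite ι
  set A := Algebra.adjoin k (Set.range f)
  set I : Ideal (MvPolynomial σ k) := Ideal.span (Set.range f)
  have hrad : ∀ i, ∃ m : ℕ, (X i : MvPolynomial σ k) ^ m ∈ I := fun i ↦ by
    change X i ∈ I.radical
    rw [← vanishingIdeal_zeroLocus_eq_radical (K := k)]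
    intro x hx
    rw [hzero x fun j ↦ by simpa using hx (f j) (Ideal.subset_span ⟨j, rfl⟩)]
    simp
  choose m hm using hrad
  set B : Set (σ →₀ ℕ) := {a | ∀ i, a i < m i} with hB
  have hBfin : B.Finite := (Set.finite_Iic (Finsupp.equivFunOnFinite.symm m)).subset
    fun a ha i ↦ (ha i).le
  set S : Submodule A (MvPolynomial σ k) := Submodule.span A ((fun a ↦ monomial a 1) '' B)
  have hsmul : ∀ (c : k) (p : MvPolynomial σ k), p ∈ S → C c * p ∈ S := fun c p hp ↦ by
    rw [← smul_eq_C_mul, ← algebraMap_smul A c p]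
    exact S.smul_mem _ hp
  obtain ⟨δ, hδ, hδd⟩ : ∃ δ : ℝ, 0 < δ ∧ ∀ j, δ ≤ d j := by
    rcases isEmpty_or_nonempty ι with h | h
    · exact ⟨1, one_pos, fun j ↦ h.elim j⟩
    · obtain ⟨j₀, hj₀⟩ := Finite.exists_min d
      exact ⟨d j₀, hd j₀, hj₀⟩
  have key : ∀ (n : ℕ) (a : σ →₀ ℕ), Finsupp.weight w a < n * δ → monomial a (1 : k) ∈ S := by
    intro n
    induction n with
    | zero =>
      intro a ha
      have : 0 ≤ Finsupp.weight w a := by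
        rw [Finsupp.weight_apply]
        exact Finset.sum_nonneg fun i _ ↦ nsmul_nonneg (hw i) _
      simp at ha
      linarith
    | succ n ih =>
      intro a ha
      by_cases haB : a ∈ B
      · exact Submodule.subset_span ⟨a, haB, rfl⟩
      obtain ⟨i, hi⟩ : ∃ i, m i ≤ a i := by simpa [hB] using haB
      have haI : monomial a (1 : k) ∈ I := by
        have : monomial a (1 : k) = monomial (a - Finsupp.single i (m i)) 1 * X i ^ m i := by
          rw [X_pow_eq_monomial, monomial_mul, one_mul, tsub_add_cancel_of_le (by simpa using hi)]
        rw [this]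
        exact I.mul_mem_left _ (hm i)
      obtain ⟨g, hg⟩ := (Submodule.mem_span_range_iff_exists_fun _).1 haI
      have hcomp := congrArg (weightedHomogeneousComponent w (Finsupp.weight w a)) hg
      rw [(isWeightedHomogeneous_monomial w a (1 : k) rfl).weightedHomogeneousComponent_same,
        map_sum] at hcomp
      rw [← hcomp]
      refine S.sum_mem fun j _ ↦ ?_
      rw [smul_eq_mul, ← sub_add_cancel (Finsupp.weight w a) (d j),
        weightedHomogeneousComponent_mul_of_right (hf j), mul_comm]
      refine S.smul_mem (⟨f j, Algebra.subset_adjoin ⟨j, rfl⟩⟩ : A) ?_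
      rw [weightedHomogeneousComponent_apply]
      refine S.sum_mem fun b hb ↦ ?_
      rw [← mul_one (coeff b _), ← C_mul_monomial]
      refine hsmul _ _ (ih b ?_)
      rw [(Finset.mem_filter.1 hb).2]
      push_cast at ha
      linarith [hδd j]
  have hfin : Module.Finite A (MvPolynomial σ k) := by
    refine ⟨Submodule.fg_def.2 ⟨(fun a ↦ monomial a 1) '' B, hBfin.image _,
      eq_top_iff.2 fun p _ ↦ ?_⟩⟩
    change p ∈ S
    rw [p.as_sum]
    refine Submodule.sum_mem _ fun a _ ↦ ?_
    rw [← mul_one (coeff a _), ← C_mul_monomial]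
    obtain ⟨n, hn⟩ := exists_nat_gt (Finsupp.weight w a / δ)
    exact hsmul _ _ (key n a ((div_lt_iff₀ hδ).1 hn))
  exact Algebra.IsIntegral.of_finite A _

theorem Derivation.apply_eq_zero_of_isAlgebraic {A R : Type*} [CommRing A] [CommRing R] [IsDomain R]
    [CharZero R] [Algebra A R] [FaithfulSMul A R] (D : Derivation A R R) {x : R}
    (hx : IsAlgebraic A x) : D x = 0 := by
  obtain ⟨p, hp0, hp⟩ := hx
  have : CharZero A := (algebraMap A R).charZero
  have : IsDomain A := (FaithfulSMul.algebraMap_injective A R).isDomain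
  induction hn : p.natDegree using Nat.strong_induction_on generalizing p with
  | _ n ih =>
    have hpos : p.natDegree ≠ 0 := fun h ↦ by
      rw [Polynomial.eq_C_of_natDegree_eq_zero h] at hp hp0
      simp at hp hp0
      exact hp0 hp
    have h := D.map_aeval p x
    rw [hp, map_zero, smul_eq_mul, eq_comm, mul_eq_zero] at h
    refine h.elim (fun h ↦ ?_) id
    exact ih _ (hn ▸ Polynomial.natDegree_derivative_lt hpos) _
      (fun h0 ↦ hpos (Polynomial.derivative_eq_zero.1 h0)) h rfl

theorem MvPolynomial.det_jacobian_ne_zero_of_isAlgebraic {σ k : Type*} [Fintype σ] [DecidableEq σ]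
    [Field k] [CharZero k] {f : σ → MvPolynomial σ k}
    (hf : Algebra.IsAlgebraic (Algebra.adjoin k (Set.range f)) (MvPolynomial σ k)) :
    (Matrix.of fun i j ↦ pderiv i (f j)).det ≠ 0 := by
  intro hdet
  obtain ⟨v, hv0, hv⟩ := Matrix.exists_vecMul_eq_zero_iff.2 hdet
  set D : Derivation k (MvPolynomial σ k) (MvPolynomial σ k) := ∑ i, v i • pderiv i with hD
  have hDapply : ∀ p, D p = ∑ i, v i * pderiv i p := fun p ↦ by
    rw [hD, ← Derivation.coeFnAddMonoidHom_apply, map_sum, Finset.sum_apply]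
    rfl
  have hDf : ∀ j, D (f j) = 0 := fun j ↦ (hDapply _).trans (congrFun hv j)
  have hDA : ∀ a ∈ Algebra.adjoin k (Set.range f), D a = 0 :=
    Derivation.eqOn_adjoin (D2 := 0) (by rintro _ ⟨j, rfl⟩; exact hDf j)
  let E : Derivation (Algebra.adjoin k (Set.range f)) (MvPolynomial σ k) (MvPolynomial σ k) :=
    .mk' { toFun := D
           map_add' := map_add D
           map_smul' := fun a p ↦ by
            simp [Algebra.smul_def, D.leibniz, hDA a a.2] } D.leibniz
  refine hv0 (_root_.funext fun i ↦ ?_)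
  have hDX : D (X i) = 0 := E.apply_eq_zero_of_isAlgebraic (hf.1 (X i))
  simpa [hDapply, pderiv_X, Pi.single_apply] using hDX

theorem MvPolynomial.isProperMap_eval_of_isIntegral {σ ι : Type*} [Finite σ] [Finite ι]
    {f : ι → MvPolynomial σ ℂ}
    (hf : Algebra.IsIntegral (Algebra.adjoin ℂ (Set.range f)) (MvPolynomial σ ℂ)) :
    IsProperMap fun (x : σ → ℂ) i ↦ eval x (f i) := by
  have := Fintype.ofFinite σ
  have := Fintype.ofFinite ι
  have hcont : Continuous fun (x : σ → ℂ) i ↦ eval x (f i) :=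
    continuous_pi fun i ↦ MvPolynomial.continuous_eval (f i)
  refine isProperMap_iff_isCompact_preimage.2 ⟨hcont, fun K hK ↦ ?_⟩
  refine Metric.isCompact_of_isClosed_isBounded (hK.isClosed.preimage hcont) ?_
  rw [← Bornology.forall_isBounded_image_eval_iff]
  intro i
  obtain ⟨p, hmonic, hp⟩ := hf.1 (X i)
  have hcoeff : ∀ n, ∃ P : MvPolynomial ι ℂ, aeval f P = (p.coeff n : MvPolynomial σ ℂ) :=
    fun n ↦ (Algebra.adjoin_range_eq_range_aeval ℂ f).le (p.coeff n).2
  choose P hP using hcoeff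
  obtain ⟨C, hC⟩ := (hK.bddAbove_image (f := fun b ↦ ∑ n ∈ Finset.range p.natDegree, ‖eval b (P n)‖)
    (continuous_finsetSum _ fun n _ ↦ (MvPolynomial.continuous_eval (P n)).norm).continuousOn)
  refine isBounded_iff_forall_norm_le.2 ⟨C + 1, ?_⟩
  rintro _ ⟨x, hx, rfl⟩
  set φ : Algebra.adjoin ℂ (Set.range f) →+* ℂ :=
    (eval x).comp (Algebra.adjoin ℂ (Set.range f)).val.toRingHom
  have hroot : (p.map φ).IsRoot (x i) := by
    have := congrArg (eval x) hp
    rw [Polynomial.hom_eval₂, map_zero, eval_X] at this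
    rwa [Polynomial.IsRoot, Polynomial.eval_map]
  have hbound := hroot.norm_lt_cauchyBound (hmonic.map φ).ne_zero
  have hle : ((p.map φ).cauchyBound : ℝ) ≤
      (∑ n ∈ Finset.range p.natDegree, ‖eval (fun j ↦ eval x (f j)) (P n)‖) + 1 := by
    rw [Polynomial.cauchyBound, (hmonic.map φ).leadingCoeff, nnnorm_one, div_one,
      hmonic.natDegree_map]
    push_cast
    gcongr
    have : ∀ n, ‖(p.map φ).coeff n‖₊ = ‖eval (fun j ↦ eval x (f j)) (P n)‖₊ := fun n ↦ by
      rw [Polynomial.coeff_map]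
      change ‖eval x (p.coeff n : MvPolynomial σ ℂ)‖₊ = _
      rw [← hP n, eval_aeval_eq_eval]
    simp_rw [this, ← coe_nnnorm]
    norm_cast
    exact Finset.sup_le fun n hn ↦ Finset.single_le_sum
      (f := fun n ↦ ‖eval (fun j ↦ eval x (f j)) (P n)‖₊) (fun _ _ ↦ zero_le) hn
  have := hC ⟨_, hx, rfl⟩
  simp only at this
  change ‖x i‖ ≤ _
  linarith

theorem MvPolynomial.isWeightedHomogeneous_one_of_eval_cpow {σ : Type*} [Finite σ]
    {W : MvPolynomial σ ℂ} {q : σ → ℝ}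
    (h : ∀ (lam : ℂ) (x : σ → ℂ), eval (fun i ↦ lam ^ (q i : ℂ) * x i) W = lam * eval x W) :
    IsWeightedHomogeneous q W 1 := by
  classical
  have := Fintype.ofFinite σ
  set φ : MvPolynomial σ ℂ →ₐ[ℂ] MvPolynomial σ ℂ :=
    aeval fun i ↦ C ((2 : ℂ) ^ (q i : ℂ)) * X i with hφ
  have hφW : φ W = C 2 * W := by
    refine MvPolynomial.funext fun x ↦ ?_
    rw [hφ, eval_aeval_eq_eval]
    simpa using h 2 x
  have hcoeff : ∀ (p : MvPolynomial σ ℂ) a,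
      coeff a (φ p) = ((2 : ℝ) ^ Finsupp.weight q a : ℝ) * coeff a p := by
    intro p a
    induction p using MvPolynomial.induction_on' with
    | add p r hp hr => simp [hp, hr, mul_add]
    | monomial b c =>
      have : φ (monomial b c) = monomial b (((2 : ℝ) ^ Finsupp.weight q b : ℝ) * c) := by
        rw [hφ, aeval_monomial, Finsupp.weight_apply, Finsupp.prod_fintype _ _ (by simp),
          Finsupp.sum_fintype _ _ (by simp), monomial_eq, Finsupp.prod_fintype _ _ (by simp)]
        simp_rw [mul_pow, Finset.prod_mul_distrib, ← map_pow, ← map_prod]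
        rw [Real.rpow_sum_of_pos two_pos, mul_comm (_ : ℂ) c, map_mul, ← mul_assoc]
        congr 3
        push_cast
        refine Finset.prod_congr rfl fun i _ ↦ ?_
        rw [nsmul_eq_mul, mul_comm, Real.rpow_mul_natCast two_pos.le]
        rw [Complex.ofReal_pow, Complex.ofReal_cpow two_pos.le]
        norm_num
      rw [this, coeff_monomial, coeff_monomial]
      split_ifs with hba <;> simp [hba]
  intro a ha
  have h2 := hcoeff W a
  rw [hφW, coeff_C_mul] at h2
  have h3 := mul_right_cancel₀ ha h2
  have h4 : (2 : ℝ) ^ (1 : ℝ) = 2 ^ Finsupp.weight q a := by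
    rw [Real.rpow_one]; exact_mod_cast h3
  exact ((Real.rpow_right_inj two_pos (by norm_num)).1 h4).symm

/-- On the line through `a` and `b`, a polynomial that is nonzero at `a` has finitely many
zeros. -/
theorem MvPolynomial.finite_setOf_eval_lineMap_eq_zero {σ k : Type*} [Field k]
    {P : MvPolynomial σ k} {a : σ → k} (ha : eval a P ≠ 0) (b : σ → k) :
    {t : k | eval (AffineMap.lineMap a b t) P = 0}.Finite := by
  set r : Polynomial k :=
    aeval (fun i ↦ Polynomial.C (a i) + Polynomial.X * Polynomial.C (b i - a i)) P with hr
  have heval : ∀ t, r.eval t = eval (AffineMap.lineMap a b t) P := fun t ↦ by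
    rw [hr, ← Polynomial.coe_aeval_eq_eval, ← AlgHom.comp_apply, comp_aeval,
      aeval_eq_eval]
    congr 2
    ext i
    simp [AffineMap.lineMap_apply, add_comm]
  have hr0 : r ≠ 0 := fun h ↦ ha (by simpa [h] using (heval 0).symm)
  refine (Polynomial.finite_setOfPred_isRoot hr0).subset fun t ht ↦ ?_
  rw [Set.mem_ofPred_eq, Polynomial.IsRoot, heval]
  exact ht

theorem IsOpen.isPathConnected_of_eval_ne_zero_subset {σ : Type*} [Finite σ] {U : Set (σ → ℂ)}
    (hU : IsOpen U) {P : MvPolynomial σ ℂ} (hP : P ≠ 0) (hPU : ∀ b, eval b P ≠ 0 → b ∈ U) :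
    IsPathConnected U := by
  have := Fintype.ofFinite σ
  have hnz : ∀ a b : σ → ℂ, eval a P ≠ 0 → eval b P ≠ 0 → JoinedIn U a b := by
    intro a b ha hb
    have hfin := finite_setOf_eval_lineMap_eq_zero ha b
    have hpc := hfin.countable.isPathConnected_compl_of_one_lt_rank
      (by rw [Complex.rank_real_complex]; norm_num)
    have hj := hpc.joinedIn 0 (by simpa using ha) 1 (by simpa using hb)
    have hc : Continuous (AffineMap.lineMap a b : ℂ → σ → ℂ) := AffineMap.lineMap_continuous
    have := hj.map hc
    simp only [AffineMap.lineMap_apply_zero, AffineMap.lineMap_apply_one] at this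
    exact this.mono (by rintro _ ⟨t, ht, rfl⟩; exact hPU _ ht)
  obtain ⟨c, hc⟩ : ∃ c, eval c P ≠ 0 := by
    by_contra! h
    exact hP (MvPolynomial.funext fun x ↦ by simp [h x])
  refine ⟨c, hPU c hc, fun {b} hb ↦ ?_⟩
  obtain ⟨ε, hε, hball⟩ := Metric.isOpen_iff.1 hU b hb
  obtain ⟨b', hb', hb'P⟩ : ∃ b' ∈ Metric.ball b ε, eval b' P ≠ 0 := by
    have hfin := finite_setOf_eval_lineMap_eq_zero hc b
    have hcl : (1 : ℂ) ∈ closure {t : ℂ | eval (AffineMap.lineMap c b t) P = 0}ᶜ :=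
      hfin.countable.dense_compl ℂ 1
    have hcont : Continuous (AffineMap.lineMap c b : ℂ → σ → ℂ) := AffineMap.lineMap_continuous
    obtain ⟨t, ht, htP⟩ := mem_closure_iff.1 hcl _
      ((Metric.isOpen_ball (x := b) (ε := ε)).preimage hcont)
      (by simpa using hε)
    exact ⟨_, ht, htP⟩
  refine (hnz c b' hc hb'P).trans ?_
  exact (((convex_ball b ε).isPathConnected ⟨b, Metric.mem_ball_self hε⟩).joinedIn _ hb' _
    (Metric.mem_ball_self hε)).mono hball

/-- the degenerate-critical-point locus
`X = {(x,b) : ∂W/∂x_i(x) + b_i = 0 ∀ i, det Hess W (x) = 0}` has image under the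
projection `π₂` to the `b`-coordinates contained in a proper algebraic hypersurface
(it is an affine variety of dimension ≤ N−1), and the set of `W`-regular linear
perturbations `b` (those making `W + ∑ b_i x_i` holomorphic Morse) is exactly the
complement of `π₂(X)` and is a non-empty, open, path-connected subset of `ℂ^N`. -/
theorem regular_perturbations_open_connected {N : ℕ} (hN : 0 < N)
    (W : MvPolynomial (Fin N) ℂ) (q : Fin N → ℝ)
    (hq : ∀ i, 0 < q i ∧ q i < 1)
    (hquasi : ∀ (lam : ℂ) (x : Fin N → ℂ),
      eval (fun i => lam ^ (q i : ℂ) * x i) W = lam * eval x W)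
    (hnondeg : ∀ x : Fin N → ℂ, (∀ i, eval x (pderiv i W) = 0) → x = 0) :
    let X : Set ((Fin N → ℂ) × (Fin N → ℂ)) :=
      {p | (∀ i, eval p.1 (pderiv i W) + p.2 i = 0) ∧
        Matrix.det (Matrix.of fun i j => eval p.1 (pderiv i (pderiv j W))) = 0}
    let Reg : Set (Fin N → ℂ) :=
      {b | ∀ x : Fin N → ℂ, (∀ i, eval x (pderiv i W) + b i = 0) →
        Matrix.det (Matrix.of fun i j => eval x (pderiv i (pderiv j W))) ≠ 0}
    Reg = (Prod.snd '' X)ᶜ ∧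
    (∃ P : MvPolynomial (Fin N) ℂ, P ≠ 0 ∧ ∀ b ∈ Prod.snd '' X, eval b P = 0) ∧
    Reg.Nonempty ∧ IsOpen Reg ∧ IsPathConnected Reg := by
  intro X Reg
  have hW := isWeightedHomogeneous_one_of_eval_cpow hquasi
  set f : Fin N → MvPolynomial (Fin N) ℂ := fun j ↦ pderiv j W with hf
  have hint : Algebra.IsIntegral (Algebra.adjoin ℂ (Set.range f)) (MvPolynomial (Fin N) ℂ) :=
    isIntegral_adjoin_range_of_weightedHomogeneous (fun i ↦ (hq i).1.le)
      (d := fun j ↦ 1 - q j) (fun j ↦ sub_pos.2 (hq j).2)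
      (fun j ↦ hW.pderiv (sub_add_cancel 1 (q j))) hnondeg
  set h : MvPolynomial (Fin N) ℂ := (Matrix.of fun i j ↦ pderiv i (f j)).det with hh
  have heval : ∀ x, Matrix.det (Matrix.of fun i j => eval x (pderiv i (pderiv j W))) = eval x h :=
    fun x ↦ by rw [hh, RingHom.map_det]; rfl
  have hh0 : h ≠ 0 := det_jacobian_ne_zero_of_isAlgebraic hint.isAlgebraic
  have hReg : Reg = (Prod.snd '' X)ᶜ := by
    ext b
    simp [Reg, X]
  have hX : Prod.snd '' X = Neg.neg ⁻¹' ((fun x j ↦ eval x (f j)) '' {x | eval x h = 0}) := by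
    ext b
    constructor
    · rintro ⟨⟨x, b⟩, ⟨hxb, hx⟩, rfl⟩
      exact ⟨x, (heval x).symm.trans hx, _root_.funext fun i ↦ eq_neg_of_add_eq_zero_left (hxb i)⟩
    · rintro ⟨x, hx, hxb⟩
      exact ⟨(x, b), ⟨fun i ↦ add_eq_zero_iff_eq_neg.2 (congrFun hxb i), (heval x).trans hx⟩, rfl⟩
  obtain ⟨⟨a, haA⟩, ha0, r, har⟩ := (hint.isAlgebraic.1 h).exists_nonzero_dvd
    (mem_nonZeroDivisors_of_ne_zero hh0)
  obtain ⟨Q, rfl⟩ : ∃ Q : MvPolynomial (Fin N) ℂ, aeval f Q = a := by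
    rwa [Algebra.adjoin_range_eq_range_aeval] at haA
  replace har : aeval f Q = h * r := har
  have hQ : ∀ x, eval (fun j ↦ eval x (f j)) Q = eval x h * eval x r := fun x ↦ by
    rw [← map_mul, ← har, eval_aeval_eq_eval]
  set P : MvPolynomial (Fin N) ℂ := aeval (fun i ↦ -MvPolynomial.X i) Q with hPdef
  have hP : ∀ b, eval b P = eval (-b) Q := fun b ↦ by
    rw [hPdef, eval_aeval_eq_eval]
    simp [Pi.neg_def]
  have hP0 : P ≠ 0 := fun h0 ↦ by
    have : Q = 0 := MvPolynomial.funext fun x ↦ by simpa [h0] using (hP (-x)).symm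
    exact ha0 (Subtype.ext (by simp [this]))
  have hPX : ∀ b ∈ Prod.snd '' X, eval b P = 0 := by
    rw [hX]
    rintro b ⟨x, hx, hxb⟩
    rw [hP, ← hxb]
    exact (hQ x).trans (by rw [show eval x h = 0 from hx, zero_mul])
  have hopen : IsOpen Reg := by
    rw [hReg, isOpen_compl_iff, hX]
    refine IsClosed.preimage continuous_neg ?_
    exact (isProperMap_eval_of_isIntegral hint).isClosedMap _
      (isClosed_eq (MvPolynomial.continuous_eval h) continuous_const)
  have hpath := hopen.isPathConnected_of_eval_ne_zero_subset hP0
    fun b hb ↦ hReg ▸ fun hbX ↦ hb (hPX b hbX)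
  exact ⟨hReg, ⟨P, hP0, hPX⟩, hpath.nonempty, hopen, hpath⟩
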